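/- arXiv:1402.0615 — 2 statements merged into one kernel-verified Lean document; each statement's English description precedes it below -/
import Mathlib

section
/- For every integer m ≥ 3, the Cartesian product P_m □ P_2 (the ladder graph) satisfies tndi(P_m □ P_2) = 5 = Δ + 2, where Δ = 3 is its maximum degree. -/
open Finset SimpleGraph

/-- A neighbor-sum-distinguishing proper total `k`-coloring of `G`:
vertex colors `cv` and edge colors `ce` taken from `{1, …, k}`, proper on
vertices, edges, and incidences, and distinguishing adjacent vertices by the
total sum of colors at each vertex. -/
def IsProperTotalColoring {V : Type*} [Fintype V] (G : SimpleGraph V) (k : ℕ)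
    (cv : V → ℕ) (ce : Sym2 V → ℕ) : Prop :=
  (∀ v, cv v ∈ Finset.Icc 1 k) ∧
  (∀ u v, G.Adj u v → ce s(u, v) ∈ Finset.Icc 1 k) ∧
  (∀ u v, G.Adj u v → cv u ≠ cv v) ∧
  (∀ u v w, G.Adj u v → G.Adj u w → v ≠ w → ce s(u, v) ≠ ce s(u, w)) ∧
  (∀ u v, G.Adj u v → ce s(u, v) ≠ cv u ∧ ce s(u, v) ≠ cv v)

open Classical in
/-- The total color-sum at a vertex: the color of `v` plus the colors of all
edges incident with `v`. -/
noncomputable def totalSum {V : Type*} [Fintype V] (G : SimpleGraph V)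
    (cv : V → ℕ) (ce : Sym2 V → ℕ) (v : V) : ℕ :=
  cv v + ∑ w ∈ Finset.univ.filter (fun w => G.Adj v w), ce s(v, w)

/-- A neighbor-sum-distinguishing proper total `k`-coloring. -/
def IsNSDColoring {V : Type*} [Fintype V] (G : SimpleGraph V) (k : ℕ)
    (cv : V → ℕ) (ce : Sym2 V → ℕ) : Prop :=
  IsProperTotalColoring G k cv ce ∧
  ∀ u v, G.Adj u v → totalSum G cv ce u ≠ totalSum G cv ce v

/-- `tndi G` is the least `k` such that `G` admits a neighbor-sum-distinguishing
proper total `k`-coloring. -/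
noncomputable def tndi {V : Type*} [Fintype V] (G : SimpleGraph V) : ℕ :=
  sInf {k | ∃ cv ce, IsNSDColoring G k cv ce}

/-- The maximum degree of a finite simple graph. -/
noncomputable def maxDeg {V : Type*} [Fintype V] (G : SimpleGraph V) : ℕ :=
  @SimpleGraph.maxDegree V G _ (Classical.decRel _)

/-- The star `S_n = K_{1,n}` with center `0` and `n` leaves. -/
def starGraph (n : ℕ) : SimpleGraph (Fin (n + 1)) :=
  SimpleGraph.fromRel fun i _ => i = 0

/-- The wheel `W_m`: hub `0` joined to every vertex of the cycle on `1, …, m`. -/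
def wheelGraph (m : ℕ) : SimpleGraph (Fin (m + 1)) :=
  SimpleGraph.fromRel fun i j =>
    i = 0 ∨ (j.val = i.val + 1 ∧ 2 ≤ j.val) ∨ (i.val = m ∧ j.val = 1)

/-- The ladder graph with `m` rungs. -/
def ladder (m : ℕ) : SimpleGraph (Fin m × Fin 2) :=
  (pathGraph m).boxProd (pathGraph 2)

lemma ladder_adj {m : ℕ} (u v : Fin m × Fin 2) :
    (ladder m).Adj u v ↔
      (u.1.val = v.1.val ∧ u.2.val ≠ v.2.val) ∨
      (u.2.val = v.2.val ∧ (u.1.val + 1 = v.1.val ∨ v.1.val + 1 = u.1.val)) := by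
  obtain ⟨i, j⟩ := u
  obtain ⟨i', j'⟩ := v
  simp only [ladder, SimpleGraph.boxProd_adj, pathGraph_adj, Fin.ext_iff]
  omega

open Classical in
lemma filter_ladder_adj_interior {m : ℕ} {p i n : Fin m} (j : Fin 2)
    (hp : p.val + 1 = i.val) (hn : i.val + 1 = n.val) :
    univ.filter (fun w => (ladder m).Adj (i, j) w) = {(i, j.rev), (p, j), (n, j)} := by
  ext ⟨a, b⟩
  simp only [mem_filter, mem_univ, true_and, ladder_adj, mem_insert, mem_singleton,
    Prod.mk.injEq, Fin.ext_iff, Fin.val_rev]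
  omega

open Classical in
lemma filter_ladder_adj_left {m : ℕ} {i n : Fin m} (j : Fin 2)
    (hi : i.val = 0) (hn : i.val + 1 = n.val) :
    univ.filter (fun w => (ladder m).Adj (i, j) w) = {(i, j.rev), (n, j)} := by
  ext ⟨a, b⟩
  simp only [mem_filter, mem_univ, true_and, ladder_adj, mem_insert, mem_singleton,
    Prod.mk.injEq, Fin.ext_iff, Fin.val_rev]
  omega

open Classical in
lemma filter_ladder_adj_right {m : ℕ} {p i : Fin m} (j : Fin 2)
    (hp : p.val + 1 = i.val) (hi : i.val + 1 = m) :
    univ.filter (fun w => (ladder m).Adj (i, j) w) = {(i, j.rev), (p, j)} := by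
  ext ⟨a, b⟩
  simp only [mem_filter, mem_univ, true_and, ladder_adj, mem_insert, mem_singleton,
    Prod.mk.injEq, Fin.ext_iff, Fin.val_rev]
  omega

open Classical in
lemma sum_ladder_adj_interior {m : ℕ} {p i n : Fin m} (j : Fin 2)
    (hp : p.val + 1 = i.val) (hn : i.val + 1 = n.val) (f : Fin m × Fin 2 → ℕ) :
    ∑ w ∈ univ.filter (fun w => (ladder m).Adj (i, j) w), f w =
      f (i, j.rev) + (f (p, j) + f (n, j)) := by
  rw [filter_ladder_adj_interior j hp hn, sum_insert, sum_pair] <;>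
    simp only [mem_insert, mem_singleton, Prod.mk.injEq, Fin.ext_iff, ne_eq] <;> omega

lemma maxDeg_ladder {m : ℕ} (hm : 3 ≤ m) : maxDeg (ladder m) = 3 := by
  classical
  let : DecidableRel (ladder m).Adj := Classical.decRel _
  change (ladder m).maxDegree = 3
  have degree_eq (v : Fin m × Fin 2) [Fintype ((ladder m).neighborSet v)] :
      (ladder m).degree v =
      (univ.filter (fun w => (ladder m).Adj v w)).card := by
    rw [← SimpleGraph.card_neighborFinset_eq_degree]
    congr 1
    ext w
    simp
  apply le_antisymm
  · refine (ladder m).maxDegree_le_of_forall_degree_le 3 ?_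
    rintro ⟨i, j⟩
    rw [degree_eq]
    rcases Nat.eq_zero_or_pos i.val with h0 | h0
    · rw [filter_ladder_adj_left (n := ⟨i + 1, by omega⟩) j h0 rfl]
      exact card_le_two.trans (by norm_num)
    · have hp : i.val - 1 + 1 = i.val := by omega
      by_cases h : i.val + 1 = m
      · rw [filter_ladder_adj_right (p := ⟨i - 1, by omega⟩) j hp h]
        exact card_le_two.trans (by norm_num)
      · rw [filter_ladder_adj_interior (p := ⟨i - 1, by omega⟩) (n := ⟨i + 1, by omega⟩) j hp rfl]
        exact card_le_three
  · refine le_trans ?_ ((ladder m).degree_le_maxDegree (⟨1, by omega⟩, 0))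
    rw [degree_eq, card_eq_sum_ones,
      sum_ladder_adj_interior (p := ⟨0, by omega⟩) (n := ⟨2, by omega⟩) 0 rfl rfl]

/-- In a proper total coloring with at most four colors, every vertex of degree three sees each
color exactly once. -/
lemma totalSum_ladder_interior {m k : ℕ} (hk : k ≤ 4) {cv : Fin m × Fin 2 → ℕ}
    {ce : Sym2 (Fin m × Fin 2) → ℕ} (h : IsProperTotalColoring (ladder m) k cv ce)
    {p i n : Fin m} (j : Fin 2) (hp : p.val + 1 = i.val) (hn : i.val + 1 = n.val) :
    totalSum (ladder m) cv ce (i, j) = 10 := by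
  obtain ⟨hv, he, -, hee, hve⟩ := h
  rw [totalSum, sum_ladder_adj_interior j hp hn]
  have hr : (ladder m).Adj (i, j) (i, j.rev) :=
    (ladder_adj _ _).2 (Or.inl ⟨rfl, by simp only [Fin.val_rev]; omega⟩)
  have hl : (ladder m).Adj (i, j) (p, j) := (ladder_adj _ _).2 (Or.inr ⟨rfl, Or.inr hp⟩)
  have hx : (ladder m).Adj (i, j) (n, j) := (ladder_adj _ _).2 (Or.inr ⟨rfl, Or.inl hn⟩)
  have hrl := hee _ _ _ hr hl (by simp only [ne_eq, Prod.mk.injEq, Fin.ext_iff]; omega)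
  have hrx := hee _ _ _ hr hx (by simp only [ne_eq, Prod.mk.injEq, Fin.ext_iff]; omega)
  have hlx := hee _ _ _ hl hx (by simp only [ne_eq, Prod.mk.injEq, Fin.ext_iff]; omega)
  have hcv := mem_Icc.1 (hv (i, j))
  have hcr := mem_Icc.1 (he _ _ hr)
  have hcl := mem_Icc.1 (he _ _ hl)
  have hcx := mem_Icc.1 (he _ _ hx)
  have hvr := (hve _ _ hr).1
  have hvl := (hve _ _ hl).1
  have hvx := (hve _ _ hx).1
  omega

/-- Rungs get color 5; the rails alternate between 3 and 4. -/
def ladderEdgeColor (m : ℕ) : Sym2 (Fin m × Fin 2) → ℕ :=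
  Sym2.lift ⟨fun u v => if u.1.val = v.1.val then 5 else 3 + min u.1.val v.1.val % 2, by
    intro u v
    simp only [eq_comm (a := u.1.val), min_comm u.1.val]⟩

/-- The vertices get the proper 2-coloring of the ladder. -/
def ladderVertexColor (m : ℕ) (v : Fin m × Fin 2) : ℕ :=
  1 + (v.1.val + v.2.val) % 2

lemma ladderEdgeColor_mk {m : ℕ} (u v : Fin m × Fin 2) :
    ladderEdgeColor m s(u, v) =
      if u.1.val = v.1.val then 5 else 3 + min u.1.val v.1.val % 2 := rfl

lemma isProperTotalColoring_ladder (m : ℕ) :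
    IsProperTotalColoring (ladder m) 5 (ladderVertexColor m) (ladderEdgeColor m) := by
  simp only [IsProperTotalColoring, ladderVertexColor, ladderEdgeColor_mk, ladder_adj, mem_Icc,
    ne_eq, Prod.ext_iff, Fin.ext_iff]
  refine ⟨?_, ?_, ?_, ?_, ?_⟩
  · intro v; omega
  · intro u v h; split_ifs <;> omega
  · intro u v h; omega
  · intro u v w huv huw hvw; split_ifs <;> omega
  · intro u v h; split_ifs <;> omega

lemma totalSum_ladderColoring {m : ℕ} (hm : 2 ≤ m) (v : Fin m × Fin 2) :
    totalSum (ladder m) (ladderVertexColor m) (ladderEdgeColor m) v =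
      ladderVertexColor m v + 5 +
        if v.1.val = 0 then 3 else if v.1.val + 1 = m then 3 + m % 2 else 7 := by
  obtain ⟨i, j⟩ := v
  rw [totalSum]
  split_ifs with h0 h
  · have h0 : i.val = 0 := h0
    rw [filter_ladder_adj_left (n := ⟨i + 1, by omega⟩) j h0 rfl, sum_pair]
    · simp only [ladderEdgeColor_mk]
      split_ifs <;> omega
    · simp only [ne_eq, Prod.mk.injEq, Fin.ext_iff]; omega
  · have h0 : ¬ i.val = 0 := h0
    have hp : i.val - 1 + 1 = i.val := by omega
    have h : i.val + 1 = m := h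
    rw [filter_ladder_adj_right (p := ⟨i - 1, by omega⟩) j hp h, sum_pair]
    · simp only [ladderEdgeColor_mk, Nat.min_eq_right (Nat.sub_le _ 1)]
      split_ifs <;> omega
    · simp only [ne_eq, Prod.mk.injEq, Fin.ext_iff]; omega
  · have h0 : ¬ i.val = 0 := h0
    have hp : i.val - 1 + 1 = i.val := by omega
    have h : ¬ i.val + 1 = m := h
    rw [sum_ladder_adj_interior (p := ⟨i - 1, by omega⟩) (n := ⟨i + 1, by omega⟩) j hp rfl]
    simp only [ladderEdgeColor_mk, Nat.min_eq_right (Nat.sub_le _ 1)]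
    split_ifs <;> omega

lemma isNSDColoring_ladder {m : ℕ} (hm : 3 ≤ m) :
    IsNSDColoring (ladder m) 5 (ladderVertexColor m) (ladderEdgeColor m) := by
  refine ⟨isProperTotalColoring_ladder m, fun u v h => ?_⟩
  rw [totalSum_ladderColoring (by omega), totalSum_ladderColoring (by omega)]
  rw [ladder_adj] at h
  simp only [ladderVertexColor]
  split_ifs <;> omega

lemma five_le_of_isNSDColoring_ladder {m k : ℕ} (hm : 3 ≤ m) {cv : Fin m × Fin 2 → ℕ}
    {ce : Sym2 (Fin m × Fin 2) → ℕ} (h : IsNSDColoring (ladder m) k cv ce) : 5 ≤ k := by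
  by_contra hk
  have hsum (j : Fin 2) : totalSum (ladder m) cv ce (⟨1, by omega⟩, j) = 10 :=
    totalSum_ladder_interior (p := ⟨0, by omega⟩) (n := ⟨2, by omega⟩) (by omega) h.1 j rfl rfl
  refine h.2 (⟨1, by omega⟩, 0) (⟨1, by omega⟩, 1) ?_ ((hsum 0).trans (hsum 1).symm)
  simp [ladder_adj]

lemma tndi_ladder {m : ℕ} (hm : 3 ≤ m) : tndi (ladder m) = 5 :=
  IsLeast.csInf_eq ⟨⟨_, _, isNSDColoring_ladder hm⟩,
    fun _ ⟨_, _, h⟩ => five_le_of_isNSDColoring_ladder hm h⟩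

theorem stmt_12 (m : ℕ) (hm : 3 ≤ m) :
    maxDeg ((pathGraph m).boxProd (pathGraph 2)) = 3 ∧
    tndi ((pathGraph m).boxProd (pathGraph 2)) = 5 :=
  ⟨maxDeg_ladder hm, tndi_ladder hm⟩
end

section
/- The Cartesian product P_3 □ P_3 of two paths on three vertices satisfies tndi(P_3 □ P_3) = 5 = Δ + 1, where Δ = 4 is its maximum degree. -/
open Finset SimpleGraph

lemma maxDeg_eq {V : Type*} [Fintype V] (G : SimpleGraph V) [DecidableRel G.Adj] :
    maxDeg G = G.maxDegree := by
  unfold maxDeg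
  congr!

open Classical in
lemma IsProperTotalColoring.maxDeg_lt {V : Type*} [Fintype V] [Nonempty V] {G : SimpleGraph V}
    {k : ℕ} {cv : V → ℕ} {ce : Sym2 V → ℕ} (h : IsProperTotalColoring G k cv ce) :
    maxDeg G < k := by
  obtain ⟨hv, he, -, hee, hve⟩ := h
  obtain ⟨v, hmax⟩ := G.exists_maximal_degree_vertex
  have hinj : Set.InjOn (fun w => ce s(v, w)) (G.neighborFinset v) := by
    intro u hu w hw huw
    by_contra hne
    exact hee v u w (by simpa using hu) (by simpa using hw) hne huw
  have hnot : cv v ∉ (G.neighborFinset v).image (fun w => ce s(v, w)) := by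
    simp only [Finset.mem_image, mem_neighborFinset, not_exists, not_and]
    exact fun w hw => (hve v w hw).1
  have hsub : insert (cv v) ((G.neighborFinset v).image fun w => ce s(v, w)) ⊆
      Finset.Icc 1 k := by
    refine Finset.insert_subset (hv v) (Finset.image_subset_iff.2 fun w hw => ?_)
    exact he v w (by simpa using hw)
  have hcard := Finset.card_le_card hsub
  rw [Finset.card_insert_of_notMem hnot, Finset.card_image_of_injOn hinj,
    card_neighborFinset_eq_degree, Nat.card_Icc, ← hmax] at hcard
  rw [maxDeg_eq]
  omega

instance decidableRelAdjPathGraph (n : ℕ) : DecidableRel (pathGraph n).Adj :=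
  fun _ _ => decidable_of_iff' _ pathGraph_adj

instance decidableRelAdjBoxProd {α β : Type*} [DecidableEq α] [DecidableEq β]
    (G : SimpleGraph α) (H : SimpleGraph β) [DecidableRel G.Adj] [DecidableRel H.Adj] :
    DecidableRel (G.boxProd H).Adj :=
  fun _ _ => decidable_of_iff' _ boxProd_adj

lemma totalSum_eq {V : Type*} [Fintype V] (G : SimpleGraph V) [DecidableRel G.Adj]
    (cv : V → ℕ) (ce : Sym2 V → ℕ) (v : V) :
    totalSum G cv ce v = cv v + ∑ w ∈ Finset.univ.filter (fun w => G.Adj v w), ce s(v, w) := by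
  unfold totalSum
  congr!

/-- A total coloring of the `3 × 3` grid drawn in the plane at twice its size: the vertex `(i, j)`
has its color at position `(2 * i, 2 * j)` and every edge has its color at its midpoint. -/
def gridColor (a b : ℕ) : ℕ :=
  ([[1, 2, 3, 1, 2], [3, 0, 4, 0, 3], [2, 1, 5, 2, 1], [4, 0, 3, 0, 4], [1, 2, 4, 1, 2]].getD a
    []).getD b 0

/-- The vertex colors read off from `gridColor`. -/
def gridVertexColor (v : Fin 3 × Fin 3) : ℕ :=
  gridColor (2 * v.1.val) (2 * v.2.val)

/-- The edge colors read off from `gridColor`. -/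
def gridEdgeColor : Sym2 (Fin 3 × Fin 3) → ℕ :=
  Sym2.lift ⟨fun u v => gridColor (u.1.val + v.1.val) (u.2.val + v.2.val),
    fun u v => by simp only [Nat.add_comm]⟩

lemma isNSDColoring_grid :
    IsNSDColoring ((pathGraph 3).boxProd (pathGraph 3)) 5 gridVertexColor gridEdgeColor := by
  refine ⟨⟨?_, ?_, ?_, ?_, ?_⟩, ?_⟩
  · decide
  · decide
  · decide
  · decide
  · decide
  · simp only [totalSum_eq]
    decide

lemma maxDeg_grid : maxDeg ((pathGraph 3).boxProd (pathGraph 3)) = 4 := by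
  rw [maxDeg_eq]
  decide

theorem stmt_13 :
    maxDeg ((pathGraph 3).boxProd (pathGraph 3)) = 4 ∧
    tndi ((pathGraph 3).boxProd (pathGraph 3)) = 5 := by
  refine ⟨maxDeg_grid, IsLeast.csInf_eq ⟨⟨_, _, isNSDColoring_grid⟩, ?_⟩⟩
  rintro k ⟨cv, ce, h, -⟩
  have := h.maxDeg_lt
  rw [maxDeg_grid] at this
  exact this
end
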